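/- (Watson's K_0 identity) For every β ∈ ℂ with Re(β) > 0, 2 ∑_{n=1}^∞ K_0(nβ) = π { 1/β + 2 ∑_{n=1}^∞ ( 1/√(β² + 4π²n²) − 1/(2nπ) ) } + γ + log(β/2) − log(2π), both series converging absolutely (the square root and logarithm are principal branches). -/

import Mathlib

open MeasureTheory Filter Complex

/-- The modified Bessel function of the second kind `K_ν(z)` for `ν, z ∈ ℂ` with `Re z > 0`,
`K_ν(z) = ∫_0^∞ e^{-z cosh t} cosh(ν t) dt`. -/
noncomputable def besselK (ν z : ℂ) : ℂ :=
  ∫ t in Set.Ioi (0:ℝ), Complex.exp (-z * Real.cosh t) * Complex.cosh (ν * t)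

open scoped Topology FourierTransform

/-- The principal square root of `β² + y²`. -/
noncomputable def sqrtSqAdd (β : ℂ) (y : ℝ) : ℂ := (β ^ 2 + (y : ℂ) ^ 2) ^ ((1 : ℂ) / 2)

section SqrtSqAdd

variable {β : ℂ}

lemma sq_add_sq_mem_slitPlane (hβ : 0 < β.re) (y : ℝ) : β ^ 2 + (y : ℂ) ^ 2 ∈ slitPlane := by
  rw [mem_slitPlane_iff]
  have h1 : (β ^ 2 + (y : ℂ) ^ 2).re = β.re ^ 2 - β.im ^ 2 + y ^ 2 := by
    simp [pow_two]
  have h2 : (β ^ 2 + (y : ℂ) ^ 2).im = 2 * β.re * β.im := by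
    simp [pow_two]; ring
  rw [h1, h2]
  rcases eq_or_ne β.im 0 with h | h
  · left; rw [h]; ring_nf; positivity
  · right; positivity

lemma sqrtSqAdd_sq (β : ℂ) (y : ℝ) : sqrtSqAdd β y ^ 2 = β ^ 2 + (y : ℂ) ^ 2 := by
  rw [sqrtSqAdd, ← cpow_nat_mul]
  norm_num

lemma sqrtSqAdd_re_pos (hβ : 0 < β.re) (y : ℝ) : 0 < (sqrtSqAdd β y).re := by
  have h := sq_add_sq_mem_slitPlane hβ y
  rw [sqrtSqAdd, cpow_def_of_ne_zero (slitPlane_ne_zero h), exp_re]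
  have h1 := neg_pi_lt_arg (β ^ 2 + (y : ℂ) ^ 2)
  have h2 := lt_of_le_of_ne (arg_le_pi (β ^ 2 + (y : ℂ) ^ 2)) (mem_slitPlane_iff_arg.1 h).1
  have h3 : (log (β ^ 2 + (y : ℂ) ^ 2) * (1 / 2)).im = arg (β ^ 2 + (y : ℂ) ^ 2) / 2 := by
    rw [show (1 / 2 : ℂ) = ((1 / 2 : ℝ) : ℂ) by norm_num, im_mul_ofReal, log_im]; ring
  rw [h3]
  exact mul_pos (Real.exp_pos _) (Real.cos_pos_of_mem_Ioo ⟨by linarith, by linarith⟩)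

lemma sqrtSqAdd_ne_zero (hβ : 0 < β.re) (y : ℝ) : sqrtSqAdd β y ≠ 0 := fun h => by
  have := sqrtSqAdd_re_pos hβ y
  simp [h] at this

lemma sqrtSqAdd_re_mul_im (β : ℂ) (y : ℝ) :
    (sqrtSqAdd β y).re * (sqrtSqAdd β y).im = β.re * β.im := by
  have h := congrArg im (sqrtSqAdd_sq β y)
  simp only [pow_two, mul_im, add_im, ofReal_re, ofReal_im] at h
  linarith

lemma le_sqrtSqAdd_re (hβ : 0 < β.re) (y : ℝ) : β.re ≤ (sqrtSqAdd β y).re := by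
  have hpos := sqrtSqAdd_re_pos hβ y
  have h := congrArg re (sqrtSqAdd_sq β y)
  have h' := sqrtSqAdd_re_mul_im β y
  simp only [pow_two, mul_re, add_re, ofReal_re, ofReal_im] at h
  set c := (sqrtSqAdd β y).re
  set d := (sqrtSqAdd β y).im
  by_contra! hlt
  have h2 : c ^ 2 < β.re ^ 2 := by nlinarith
  have h3 : c ^ 2 * d ^ 2 = β.re ^ 2 * β.im ^ 2 := by
    rw [← mul_pow, h', mul_pow]
  have h4 : β.im ^ 2 ≤ d ^ 2 := by
    by_contra! h5
    nlinarith [sq_nonneg d, mul_pos (sq_pos_of_pos hβ) (sub_pos.2 h5), mul_nonneg (sq_nonneg d) (sub_pos.2 h2).le]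
  nlinarith [sq_nonneg y]

lemma sqrtSqAdd_zero (hβ : 0 < β.re) : sqrtSqAdd β 0 = β := by
  have h := sqrtSqAdd_sq β 0
  have h1 := sqrtSqAdd_re_pos hβ 0
  simp only [ofReal_zero, ne_eq, OfNat.ofNat_ne_zero, not_false_eq_true, zero_pow, add_zero] at h
  rcases sq_eq_sq_iff_eq_or_eq_neg.1 h with h | h
  · exact h
  · rw [h, neg_re] at h1; linarith

lemma sqrtSqAdd_neg (β : ℂ) (y : ℝ) : sqrtSqAdd β (-y) = sqrtSqAdd β y := by
  simp [sqrtSqAdd]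

lemma sqrtSqAdd_ofReal {b : ℝ} (y : ℝ) :
    sqrtSqAdd b y = (√(b ^ 2 + y ^ 2) : ℝ) := by
  rw [sqrtSqAdd, Real.sqrt_eq_rpow, ofReal_cpow (by positivity)]
  push_cast; rfl

lemma sqrtSqAdd_div_re_pos (hβ : 0 < β.re) (y : ℝ) : 0 < (sqrtSqAdd β y / β).re := by
  have hpos := sqrtSqAdd_re_pos hβ y
  have h' := sqrtSqAdd_re_mul_im β y
  have hn : 0 < normSq β := normSq_pos.2 fun h => by simp [h] at hβ
  rw [div_re]
  set c := (sqrtSqAdd β y).re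
  set d := (sqrtSqAdd β y).im
  have hd : 0 ≤ d * β.im := by
    have : 0 ≤ c * (d * β.im) := by
      rw [← mul_assoc, h']; nlinarith [mul_nonneg hβ.le (sq_nonneg β.im)]
    exact nonneg_of_mul_nonneg_right this hpos
  positivity

lemma hasDerivAt_sqrtSqAdd (hβ : 0 < β.re) (y : ℝ) :
    HasDerivAt (sqrtSqAdd β) (y / sqrtSqAdd β y) y := by
  have h1 : HasDerivAt (fun z : ℂ => β ^ 2 + z ^ 2) (2 * (y : ℂ)) y := by
    simpa using! ((hasDerivAt_id (y : ℂ)).pow 2).const_add (β ^ 2)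
  have hs := sq_add_sq_mem_slitPlane hβ y
  have h2 := (h1.cpow_const (c := (1 : ℂ) / 2) hs).comp_ofReal
  refine h2.congr_deriv ?_
  rw [cpow_sub _ _ (slitPlane_ne_zero hs), cpow_one, ← sqrtSqAdd, ← sqrtSqAdd_sq]
  field_simp [sqrtSqAdd_ne_zero hβ y]

lemma continuous_sqrtSqAdd (hβ : 0 < β.re) : Continuous (sqrtSqAdd β) :=
  continuous_iff_continuousAt.2 fun y => (hasDerivAt_sqrtSqAdd hβ y).continuousAt

lemma norm_sqrtSqAdd_sub_le (hβ : 0 < β.re) {y : ℝ} (hy : 0 < y) :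
    ‖sqrtSqAdd β y - y‖ ≤ ‖β‖ ^ 2 / y := by
  have h : (sqrtSqAdd β y - y) * (sqrtSqAdd β y + y) = β ^ 2 := by
    linear_combination sqrtSqAdd_sq β y
  have h2 : y ≤ ‖sqrtSqAdd β y + y‖ := by
    refine le_trans ?_ (re_le_norm _)
    simpa using! (sqrtSqAdd_re_pos hβ y).le
  rw [le_div_iff₀ hy, ← norm_pow, ← h, norm_mul]
  gcongr

lemma norm_one_div_sqrtSqAdd_sub_le (hβ : 0 < β.re) {y : ℝ} (hy : 0 < y) :
    ‖1 / sqrtSqAdd β y - 1 / y‖ ≤ ‖β‖ ^ 2 / β.re / y ^ 2 := by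
  have hr : β.re ≤ ‖sqrtSqAdd β y‖ := (le_sqrtSqAdd_re hβ y).trans (re_le_norm _)
  have hy' : (y : ℂ) ≠ 0 := by exact_mod_cast hy.ne'
  rw [div_sub_div _ _ (sqrtSqAdd_ne_zero hβ y) hy', one_mul, mul_one, norm_div, norm_mul,
    norm_sub_rev, norm_real, Real.norm_of_nonneg hy.le]
  calc _ ≤ (‖β‖ ^ 2 / y) / (β.re * y) := by
        gcongr
        exact norm_sqrtSqAdd_sub_le hβ hy
    _ = _ := by field_simp

lemma summable_one_div_sqrtSqAdd (hβ : 0 < β.re) :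
    Summable fun n : ℕ => 1 / sqrtSqAdd β (2 * Real.pi * (n + 1 : ℕ)) -
      1 / ((2 * Real.pi * (n + 1 : ℕ) : ℝ) : ℂ) := by
  have h : Summable fun n : ℕ => ‖β‖ ^ 2 / β.re / (2 * Real.pi) ^ 2 * (1 / ((n + 1 : ℕ) : ℝ) ^ 2) :=
    ((summable_nat_add_iff 1).2 (Real.summable_one_div_nat_pow.2 one_lt_two)).mul_left _
  refine h.of_norm_bounded fun n => ?_
  refine (norm_one_div_sqrtSqAdd_sub_le hβ (by positivity)).trans_eq ?_
  rw [mul_pow]; field_simp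

lemma isBigO_one_div_sqrtSqAdd_sub {α : ℂ} (hβ : 0 < β.re) (hα : 0 < α.re) :
    (fun y : ℝ => 1 / sqrtSqAdd β y - 1 / sqrtSqAdd α y) =O[cocompact ℝ]
      fun y : ℝ => |y| ^ (-2 : ℝ) := by
  refine Asymptotics.IsBigO.of_bound (‖β‖ ^ 2 / β.re + ‖α‖ ^ 2 / α.re) ?_
  have h0 : {(0 : ℝ)}ᶜ ∈ cocompact ℝ := isCompact_singleton.compl_mem_cocompact
  filter_upwards [h0] with y hy
  have hy' : 0 < |y| := abs_pos.2 hy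
  have habs : ∀ γ : ℂ, sqrtSqAdd γ y = sqrtSqAdd γ |y| := fun γ => by
    rcases abs_choice y with h | h <;> rw [h]
    rw [sqrtSqAdd_neg]
  rw [Real.norm_of_nonneg (by positivity), Real.rpow_neg hy'.le, habs, habs,
    show (2 : ℝ) = (2 : ℕ) by norm_num, Real.rpow_natCast, ← div_eq_mul_inv, add_div]
  calc _ = ‖(1 / sqrtSqAdd β |y| - 1 / (|y| : ℝ)) - (1 / sqrtSqAdd α |y| - 1 / (|y| : ℝ))‖ := by
        congr 1; ring
    _ ≤ _ := (norm_sub_le _ _).trans (add_le_add (norm_one_div_sqrtSqAdd_sub_le hβ hy')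
        (norm_one_div_sqrtSqAdd_sub_le hα hy'))

lemma continuous_one_div_sqrtSqAdd (hβ : 0 < β.re) :
    Continuous fun y : ℝ => 1 / sqrtSqAdd β y :=
  continuous_const.div (continuous_sqrtSqAdd hβ) (sqrtSqAdd_ne_zero hβ)

lemma integrable_one_div_sqrtSqAdd_sub {α : ℂ} (hβ : 0 < β.re) (hα : 0 < α.re) :
    Integrable fun y : ℝ => 1 / sqrtSqAdd β y - 1 / sqrtSqAdd α y := by
  have hc : Continuous fun y : ℝ => 1 / sqrtSqAdd β y - 1 / sqrtSqAdd α y :=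
    (continuous_one_div_sqrtSqAdd hβ).sub (continuous_one_div_sqrtSqAdd hα)
  have hO := (isBigO_one_div_sqrtSqAdd_sub hβ hα).mono atTop_le_cocompact
  refine hc.locallyIntegrable.integrable_of_isBigO_atTop_of_norm_isNegInvariant
    (g := fun y : ℝ => y ^ (-2 : ℝ)) ?_ (hO.congr' EventuallyEq.rfl ?_)
    (integrableAtFilter_rpow_atTop_iff.2 (by norm_num))
  · exact Eventually.of_forall fun y => by simp [sqrtSqAdd_neg]
  · filter_upwards [eventually_ge_atTop 0] with y hy
    rw [abs_of_nonneg hy]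

lemma integral_Ioi_one_div_sqrtSqAdd_sub {α : ℂ} (hβ : 0 < β.re) (hα : 0 < α.re) :
    ∫ y in Set.Ioi (0 : ℝ), (1 / sqrtSqAdd β y - 1 / sqrtSqAdd α y) = log α - log β := by
  have hre : ∀ {γ : ℂ}, 0 < γ.re → ∀ y : ℝ, 0 ≤ y → (y + sqrtSqAdd γ y) ∈ slitPlane :=
    fun hγ y hy => Or.inl <| by
      simpa using! add_pos_of_nonneg_of_pos hy (sqrtSqAdd_re_pos hγ y)
  have hd : ∀ {γ : ℂ}, 0 < γ.re → ∀ y : ℝ, 0 ≤ y →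
      HasDerivAt (fun y : ℝ => log (y + sqrtSqAdd γ y)) (1 / sqrtSqAdd γ y) y := by
    intro γ hγ y hy
    have h1 := ((hasDerivAt_id y).ofReal_comp.add (hasDerivAt_sqrtSqAdd hγ y)).clog_real
      (hre hγ y hy)
    refine h1.congr_deriv ?_
    have := slitPlane_ne_zero (hre hγ y hy)
    have := sqrtSqAdd_ne_zero hγ y
    simp only [id, ofReal_one]
    rw [div_eq_div_iff ‹_› ‹_›]
    field_simp
    simp [add_comm]
  have ht : ∀ {γ : ℂ}, 0 < γ.re →
      Tendsto (fun y : ℝ => log (y + sqrtSqAdd γ y) - Real.log y) atTop (𝓝 (log 2)) := by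
    intro γ hγ
    have h1 : Tendsto (fun y : ℝ => (sqrtSqAdd γ y - y) * (1 / y : ℝ)) atTop (𝓝 (0 * (0 : ℝ))) := by
      refine Tendsto.mul ?_ ?_
      · refine squeeze_zero_norm' (a := fun y : ℝ => ‖γ‖ ^ 2 / y) ?_ ?_
        · filter_upwards [eventually_gt_atTop 0] with y hy using norm_sqrtSqAdd_sub_le hγ hy
        · exact tendsto_const_nhds.div_atTop tendsto_id
      · exact (continuous_ofReal.tendsto 0).comp (tendsto_const_nhds.div_atTop tendsto_id)
    have h2 : Tendsto (fun y : ℝ => (2 : ℂ) + (sqrtSqAdd γ y - y) * (1 / y : ℝ)) atTop (𝓝 2) := by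
      simpa using! h1.const_add 2
    refine (h2.clog (by simp [slitPlane])).congr' ?_
    filter_upwards [eventually_gt_atTop 0] with y hy
    have hy' : (y : ℂ) ≠ 0 := by exact_mod_cast hy.ne'
    have h3 : (y : ℂ) + sqrtSqAdd γ y =
        (y : ℂ) * ((2 : ℂ) + (sqrtSqAdd γ y - y) * (1 / y : ℝ)) := by
      push_cast; field_simp; ring
    have h4 := slitPlane_ne_zero (hre hγ y hy.le)
    rw [h3] at h4 ⊢
    rw [log_ofReal_mul hy (right_ne_zero_of_mul h4)]
    ring
  have := integral_Ioi_of_hasDerivAt_of_tendsto' (a := 0) (m := log 2 - log 2)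
    (fun y hy => (hd hβ y hy).sub (hd hα y hy))
    (integrable_one_div_sqrtSqAdd_sub hβ hα).integrableOn
    (((ht hβ).sub (ht hα)).congr fun y => by simp)
  rw [this]
  simp [sqrtSqAdd_zero hβ, sqrtSqAdd_zero hα]

lemma integral_one_div_sqrtSqAdd_sub {α : ℂ} (hβ : 0 < β.re) (hα : 0 < α.re) :
    ∫ y : ℝ, (1 / sqrtSqAdd β y - 1 / sqrtSqAdd α y) = 2 * (log α - log β) := by
  have hi := integrable_one_div_sqrtSqAdd_sub hβ hα
  rw [← intervalIntegral.integral_Iic_add_Ioi (b := 0) hi.integrableOn hi.integrableOn,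
    ← neg_zero (G := ℝ), ← integral_comp_neg_Ioi]
  simp_rw [sqrtSqAdd_neg]
  rw [neg_zero, integral_Ioi_one_div_sqrtSqAdd_sub hβ hα]
  ring

end SqrtSqAdd

section BesselK

variable {β : ℂ}

lemma besselK_zero_left (z : ℂ) :
    besselK 0 z = ∫ t in Set.Ioi (0 : ℝ), exp (-z * Real.cosh t) := by
  simp [besselK]

lemma integrableOn_inv_cosh : IntegrableOn (fun t : ℝ => (Real.cosh t)⁻¹) (Set.Ioi 0) := by
  have h : IntegrableOn (fun t : ℝ => 2 * Real.exp (-t)) (Set.Ioi 0) :=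
    (integrableOn_exp_neg_Ioi 0).const_mul 2
  refine Integrable.mono' h ?_ (Eventually.of_forall fun t => ?_)
  · exact (Real.continuous_cosh.inv₀ fun t => (Real.cosh_pos t).ne').aestronglyMeasurable
  · rw [Real.norm_of_nonneg (inv_nonneg.2 (Real.cosh_pos t).le), inv_le_iff_one_le_mul₀
      (Real.cosh_pos t), Real.cosh_eq]
    have h1 : Real.exp (-t) * Real.exp t = 1 := by rw [← Real.exp_add]; simp
    nlinarith [sq_nonneg (Real.exp (-t))]

lemma integrableOn_exp_neg_mul_cosh {s : ℝ} (hs : 0 < s) :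
    IntegrableOn (fun t : ℝ => Real.exp (-s * Real.cosh t)) (Set.Ioi 0) := by
  refine Integrable.mono' (integrableOn_inv_cosh.const_mul s⁻¹) ?_ (Eventually.of_forall fun t => ?_)
  · exact Continuous.aestronglyMeasurable (by fun_prop)
  · have h0 : 0 < s * Real.cosh t := mul_pos hs (Real.cosh_pos t)
    rw [Real.norm_of_nonneg (Real.exp_pos _).le, ← mul_inv, neg_mul, Real.exp_neg]
    exact inv_anti₀ h0 (by linarith [Real.add_one_le_exp (s * Real.cosh t)])

lemma norm_exp_neg_mul_cosh (z : ℂ) (t : ℝ) :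
    ‖exp (-z * Real.cosh t)‖ = Real.exp (-z.re * Real.cosh t) := by
  rw [norm_exp, re_mul_ofReal, neg_re]

lemma norm_besselK_zero_le (hβ : 0 < β.re) {x : ℝ} (hx : 1 ≤ x) :
    ‖besselK 0 (x * β)‖ ≤ Real.exp (-(x - 1) * β.re) *
      ∫ t in Set.Ioi (0 : ℝ), Real.exp (-β.re * Real.cosh t) := by
  rw [besselK_zero_left, ← integral_const_mul]
  refine norm_integral_le_of_norm_le ((integrableOn_exp_neg_mul_cosh hβ).const_mul _)
    (Eventually.of_forall fun t => ?_)
  rw [norm_exp_neg_mul_cosh, ← Real.exp_add, re_ofReal_mul, Real.exp_le_exp]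
  nlinarith [mul_nonneg (mul_nonneg (sub_nonneg.2 hx) hβ.le) (sub_nonneg.2 (Real.one_le_cosh t))]

lemma summable_besselK_zero (hβ : 0 < β.re) :
    Summable fun n : ℕ => besselK 0 ((n + 1 : ℕ) * β) := by
  have h : Summable fun n : ℕ => Real.exp (n * -β.re) *
      ∫ t in Set.Ioi (0 : ℝ), Real.exp (-β.re * Real.cosh t) :=
    (Real.summable_exp_nat_mul_iff.2 (neg_lt_zero.2 hβ)).mul_right _
  refine h.of_norm_bounded fun n => ?_
  have := norm_besselK_zero_le hβ (x := (n + 1 : ℕ)) (by simp)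
  push_cast at this ⊢
  convert this using 3
  ring

lemma continuousAt_besselK_zero (hβ : 0 < β.re) {x : ℝ} (hx : x ≠ 0) :
    ContinuousAt (fun x : ℝ => besselK 0 (|x| * β)) x := by
  have h0 : 0 < |x| := abs_pos.2 hx
  simp_rw [besselK_zero_left]
  refine continuousAt_of_dominated
    (bound := fun t => Real.exp (-(|x| / 2 * β.re) * Real.cosh t)) ?_ ?_
    (integrableOn_exp_neg_mul_cosh (by positivity)) ?_
  · exact Eventually.of_forall fun y => Continuous.aestronglyMeasurable (by fun_prop)
  · have hn : ∀ᶠ y : ℝ in 𝓝 x, |x| / 2 < |y| :=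
      continuous_abs.continuousAt.eventually_const_lt (by linarith)
    filter_upwards [hn] with y hy
    refine Eventually.of_forall fun t => ?_
    rw [norm_exp_neg_mul_cosh, re_ofReal_mul]
    have := Real.cosh_pos t
    gcongr
  · exact Eventually.of_forall fun t => Continuous.continuousAt (by fun_prop)

lemma integrable_exp_mul_exp_neg_abs {c : ℂ} (hc : 0 < c.re) (y : ℝ) :
    Integrable (fun x : ℝ => exp (-(y * x) * I) * exp (-c * |x|)) ∧
      ∫ x : ℝ, exp (-(y * x) * I) * exp (-c * |x|) = 2 * c / (c ^ 2 + (y : ℂ) ^ 2) := by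
  have e1 : Set.EqOn (fun x : ℝ => exp ((-c - y * I) * x))
      (fun x : ℝ => exp (-(y * x) * I) * exp (-c * |x|)) (Set.Ioi 0) := fun x hx => by
    simp only [abs_of_pos (Set.mem_Ioi.1 hx), ← exp_add]; congr 1; ring
  have e2 : Set.EqOn (fun x : ℝ => exp ((c - y * I) * x))
      (fun x : ℝ => exp (-(y * x) * I) * exp (-c * |x|)) (Set.Iic 0) := fun x hx => by
    simp only [abs_of_nonpos (Set.mem_Iic.1 hx), ← exp_add]; congr 1; push_cast; ring
  have h1 : (-c - y * I).re < 0 := by simpa using hc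
  have h2 : 0 < (c - y * I).re := by simpa using hc
  have i1 := (integrableOn_exp_mul_complex_Ioi h1 0).congr_fun e1 measurableSet_Ioi
  have i2 := (integrableOn_exp_mul_complex_Iic h2 0).congr_fun e2 measurableSet_Iic
  constructor
  · rw [← integrableOn_univ, ← Set.Iic_union_Ioi (a := (0 : ℝ))]
    exact i2.union i1
  · rw [← intervalIntegral.integral_Iic_add_Ioi i2 i1, ← setIntegral_congr_fun measurableSet_Ioi e1,
      ← setIntegral_congr_fun measurableSet_Iic e2, integral_exp_mul_complex_Ioi h1,
      integral_exp_mul_complex_Iic h2]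
    have n1 : -c - y * I ≠ 0 := fun h => by simp [h] at h1
    have n2 : c - y * I ≠ 0 := fun h => by simp [h] at h2
    have e : c ^ 2 + (y : ℂ) ^ 2 = -((-c - y * I) * (c - y * I)) := by
      linear_combination (y : ℂ) ^ 2 * I_sq
    rw [e]
    simp only [ofReal_zero, mul_zero, exp_zero]
    field_simp
    ring

lemma integral_exp_neg_mul_abs {a : ℝ} (ha : 0 < a) :
    ∫ x : ℝ, Real.exp (-a * |x|) = 2 * a⁻¹ := by
  rw [integral_comp_abs (f := fun x => Real.exp (-a * x)), integral_exp_mul_Ioi (by linarith)]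
  simp

lemma integrable_prod_exp_mul_exp_neg_cosh (hβ : 0 < β.re) (y : ℝ) :
    Integrable (Function.uncurry fun x t : ℝ =>
      exp (-(y * x) * I) * exp (-(|x| * β) * Real.cosh t))
      (volume.prod (volume.restrict (Set.Ioi (0 : ℝ)))) := by
  have hc : ∀ t : ℝ, 0 < (β * Real.cosh t).re := fun t => by
    rw [re_mul_ofReal]; exact mul_pos hβ (Real.cosh_pos t)
  rw [integrable_prod_iff']
  · constructor
    · refine Eventually.of_forall fun t => ?_
      refine (integrable_exp_mul_exp_neg_abs (hc t) y).1.congr (Eventually.of_forall fun x => ?_)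
      simp only [Function.uncurry_apply_pair]
      congr 2; ring
    · refine (integrableOn_inv_cosh.const_mul (2 * β.re⁻¹)).congr (Eventually.of_forall fun t => ?_)
      have := integral_exp_neg_mul_abs (hc t)
      rw [re_mul_ofReal, mul_inv, ← mul_assoc] at this
      simp only [Function.uncurry_apply_pair, norm_mul, norm_exp_neg_mul_cosh]
      rw [← this]
      refine integral_congr_ae (Eventually.of_forall fun x => ?_)
      have h1 : ‖exp (-(y * x) * I)‖ = 1 := by
        exact_mod_cast norm_exp_ofReal_mul_I (-(y * x))
      simp only [h1, one_mul, re_ofReal_mul]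
      congr 1; ring
  · exact Continuous.aestronglyMeasurable (by fun_prop)

lemma integrable_besselK_zero (hβ : 0 < β.re) :
    Integrable fun x : ℝ => besselK 0 (|x| * β) := by
  have := (integrable_prod_exp_mul_exp_neg_cosh hβ 0).integral_prod_left
  simpa [besselK_zero_left] using this

lemma tendsto_log_add_mul_I_sub {q : ℂ} (hq : 0 < q.re) :
    Tendsto (fun s : ℝ => log (q + s * I) - log (q - s * I)) atTop (𝓝 (Real.pi * I)) := by
  have h0 : Tendsto (fun s : ℝ => q * ((1 / s : ℝ) : ℂ)) atTop (𝓝 (q * (0 : ℝ))) :=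
    ((continuous_ofReal.tendsto 0).comp
      (tendsto_const_nhds.div_atTop tendsto_id)).const_mul q
  rw [ofReal_zero, mul_zero] at h0
  have h1 : Tendsto (fun s : ℝ => log (q * ((1 / s : ℝ) : ℂ) + I) - log (q * ((1 / s : ℝ) : ℂ) - I))
      atTop (𝓝 (log (0 + I) - log (0 - I))) :=
    ((h0.add_const I).clog (by simp [slitPlane])).sub ((h0.sub_const I).clog (by simp [slitPlane]))
  have h2 : log (0 + I) - log (0 - I) = Real.pi * I := by
    rw [zero_add, zero_sub, log_I, log_neg_I]; ring
  rw [h2] at h1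
  refine h1.congr' ?_
  filter_upwards [eventually_gt_atTop 0] with s hs
  have hs' : (s : ℂ) ≠ 0 := by exact_mod_cast hs.ne'
  have n1 : q * ((1 / s : ℝ) : ℂ) + I ≠ 0 := fun h => by
    have := congrArg re h
    rw [add_re, re_mul_ofReal, I_re, zero_re] at this
    have : 0 < q.re * (1 / s) := by positivity
    linarith
  have n2 : q * ((1 / s : ℝ) : ℂ) - I ≠ 0 := fun h => by
    have := congrArg re h
    rw [sub_re, re_mul_ofReal, I_re, zero_re] at this
    have : 0 < q.re * (1 / s) := by positivity
    linarith
  have e1 : q + s * I = s * (q * ((1 / s : ℝ) : ℂ) + I) := by push_cast; field_simp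
  have e2 : q - s * I = s * (q * ((1 / s : ℝ) : ℂ) - I) := by push_cast; field_simp
  rw [e1, e2, log_ofReal_mul hs n1, log_ofReal_mul hs n2]
  ring

lemma hasDerivAt_log_add_sinh_mul_I {q : ℂ} (hq : 0 < q.re) (t : ℝ) :
    HasDerivAt (fun t : ℝ => log (q + Real.sinh t * I) - log (q - Real.sinh t * I))
      (2 * q * Real.cosh t * I / (q ^ 2 + (Real.sinh t : ℂ) ^ 2)) t := by
  have h0 := ((Real.hasDerivAt_sinh t).ofReal_comp).mul_const I
  have s1 : q + Real.sinh t * I ∈ slitPlane := Or.inl <| by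
    rwa [add_re, re_ofReal_mul, I_re, mul_zero, add_zero]
  have s2 : q - Real.sinh t * I ∈ slitPlane := Or.inl <| by
    rwa [sub_re, re_ofReal_mul, I_re, mul_zero, sub_zero]
  have n1 := slitPlane_ne_zero s1
  have n2 := slitPlane_ne_zero s2
  refine (((h0.const_add q).clog_real s1).sub ((h0.const_sub q).clog_real s2)).congr_deriv ?_
  have e : q ^ 2 + (Real.sinh t : ℂ) ^ 2 = (q + Real.sinh t * I) * (q - Real.sinh t * I) := by
    linear_combination (Real.sinh t : ℂ) ^ 2 * I_sq
  rw [e, div_sub_div _ _ n1 n2]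
  congr 1
  ring

lemma fourier_besselK_zero (hβ : 0 < β.re) (ξ : ℝ) :
    𝓕 (fun x : ℝ => besselK 0 (|x| * β)) ξ =
      Real.pi * (1 / sqrtSqAdd β (2 * Real.pi * ξ)) := by
  set y := 2 * Real.pi * ξ with hy
  have hint := integrable_prod_exp_mul_exp_neg_cosh hβ y
  have hr := sqrtSqAdd_ne_zero hβ y
  have hβ0 : β ≠ 0 := fun h => by simp [h] at hβ
  have hq := sqrtSqAdd_div_re_pos hβ y
  have hinner : ∀ t : ℝ, ∫ x : ℝ, exp (-(y * x) * I) * exp (-(|x| * β) * Real.cosh t) =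
      (1 / (sqrtSqAdd β y * I)) * (2 * (sqrtSqAdd β y / β) * Real.cosh t * I /
        ((sqrtSqAdd β y / β) ^ 2 + (Real.sinh t : ℂ) ^ 2)) := fun t => by
    have hc : 0 < (β * Real.cosh t).re := by
      rw [re_mul_ofReal]; exact mul_pos hβ (Real.cosh_pos t)
    have h := (integrable_exp_mul_exp_neg_abs hc y).2
    have hch : (Real.cosh t : ℂ) ^ 2 = (Real.sinh t : ℂ) ^ 2 + 1 := by
      exact_mod_cast Real.cosh_sq t
    have e : (β * Real.cosh t) ^ 2 + (y : ℂ) ^ 2 =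
        β ^ 2 * ((sqrtSqAdd β y / β) ^ 2 + (Real.sinh t : ℂ) ^ 2) := by
      rw [mul_add, ← mul_pow, mul_div_cancel₀ _ hβ0, sqrtSqAdd_sq]
      linear_combination β ^ 2 * hch
    rw [e] at h
    calc _ = _ := integral_congr_ae (Eventually.of_forall fun x => by congr 2; ring_nf)
      _ = _ := h
      _ = _ := by
        rw [mul_div_assoc', ← div_div]
        congr 1
        have := I_ne_zero
        field_simp
  have hint2 := hint.integral_prod_right
  simp only [Function.uncurry_apply_pair] at hint2
  simp_rw [hinner] at hint2
  have hint3 := (integrable_const_mul_iff (isUnit_iff_ne_zero.2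
    (one_div_ne_zero (mul_ne_zero hr I_ne_zero))) _).1 hint2
  rw [Real.fourier_real_eq_integral_exp_smul]
  calc _ = ∫ x : ℝ, ∫ t in Set.Ioi (0 : ℝ),
          exp (-(y * x) * I) * exp (-(|x| * β) * Real.cosh t) := by
        refine integral_congr_ae (Eventually.of_forall fun x => ?_)
        simp only [besselK_zero_left, smul_eq_mul, ← integral_const_mul]
        congr 4
        rw [hy]; push_cast; ring_nf
    _ = _ := integral_integral_swap hint
    _ = _ := by
        simp_rw [hinner]
        rw [integral_const_mul, integral_Ioi_of_hasDerivAt_of_tendsto'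
          (fun t _ => hasDerivAt_log_add_sinh_mul_I hq t) hint3
          ((tendsto_log_add_mul_I_sub hq).comp Real.sinhOrderIso.tendsto_atTop)]
        have := I_ne_zero
        simp only [Real.sinh_zero, ofReal_zero, zero_mul, add_zero, sub_zero, sub_self]
        field_simp

end BesselK

section Poisson

lemma hasSum_int_of_even {f : ℤ → ℂ} (hf : ∀ n, f (-n) = f n)
    (hs : Summable fun n : ℕ => f (n + 1 : ℕ)) :
    HasSum f (f 0 + 2 * ∑' n : ℕ, f (n + 1 : ℕ)) := by
  have hs' : Summable fun n : ℕ => f n := (summable_nat_add_iff (f := fun n : ℕ => f n) 1).1 hs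
  have h1 : HasSum (fun n : ℕ => f n) (f 0 + ∑' n : ℕ, f (n + 1 : ℕ)) := by
    have := hs'.hasSum
    rwa [hs'.tsum_eq_zero_add] at this
  have h2 : HasSum (fun n : ℕ => f (-(n + 1))) (∑' n : ℕ, f (n + 1 : ℕ)) := by
    simp only [hf]
    exact_mod_cast hs.hasSum
  convert h1.of_nat_of_neg_add_one h2 using 1
  ring

variable {α β : ℂ}

lemma integrable_one_div_sqrtSqAdd_two_pi_mul_sub (hβ : 0 < β.re) (hα : 0 < α.re) :
    Integrable fun ξ : ℝ => 1 / sqrtSqAdd β (2 * Real.pi * ξ) - 1 / sqrtSqAdd α (2 * Real.pi * ξ) :=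
  (integrable_one_div_sqrtSqAdd_sub hβ hα).comp_mul_left' (R := 2 * Real.pi) Real.two_pi_pos.ne'

lemma fourier_besselK_zero_sub (hβ : 0 < β.re) (hα : 0 < α.re) :
    𝓕 (fun x : ℝ => besselK 0 (|x| * β) - besselK 0 (|x| * α)) = fun ξ : ℝ =>
      Real.pi * (1 / sqrtSqAdd β (2 * Real.pi * ξ) - 1 / sqrtSqAdd α (2 * Real.pi * ξ)) := by
  ext ξ
  have h : 𝓕 (fun x : ℝ => besselK 0 (|x| * β) - besselK 0 (|x| * α)) ξ =
      𝓕 (fun x : ℝ => besselK 0 (|x| * β)) ξ - 𝓕 (fun x : ℝ => besselK 0 (|x| * α)) ξ := by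
    simp only [Real.fourier_eq, smul_sub]
    exact integral_sub ((Real.fourierIntegral_convergent_iff ξ).2 (integrable_besselK_zero hβ))
      ((Real.fourierIntegral_convergent_iff ξ).2 (integrable_besselK_zero hα))
  rw [h, fourier_besselK_zero hβ, fourier_besselK_zero hα, mul_sub]

lemma fourier_one_div_sqrtSqAdd_sub (hβ : 0 < β.re) (hα : 0 < α.re) {x : ℝ} (hx : x ≠ 0) :
    𝓕 (fun ξ : ℝ =>
      Real.pi * (1 / sqrtSqAdd β (2 * Real.pi * ξ) - 1 / sqrtSqAdd α (2 * Real.pi * ξ))) x =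
      besselK 0 (|x| * β) - besselK 0 (|x| * α) := by
  have hi := (integrable_besselK_zero hβ).sub (integrable_besselK_zero hα)
  have hF := fourier_besselK_zero_sub hβ hα
  have h := hi.fourierInv_fourier_eq (v := -x)
    (hF ▸ (integrable_one_div_sqrtSqAdd_two_pi_mul_sub hβ hα).const_mul _)
    ((continuousAt_besselK_zero hβ (neg_ne_zero.2 hx)).sub
      (continuousAt_besselK_zero hα (neg_ne_zero.2 hx)))
  rw [Real.fourierInv_eq_fourier_neg, neg_neg] at h
  rw [← hF]
  simpa using! h

lemma fourier_one_div_sqrtSqAdd_sub_zero (hβ : 0 < β.re) (hα : 0 < α.re) :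
    𝓕 (fun ξ : ℝ =>
      Real.pi * (1 / sqrtSqAdd β (2 * Real.pi * ξ) - 1 / sqrtSqAdd α (2 * Real.pi * ξ))) 0 =
      log α - log β := by
  rw [Real.fourier_real_eq]
  simp only [mul_zero, neg_zero, AddChar.map_zero_eq_one, one_smul]
  rw [integral_const_mul, Measure.integral_comp_mul_left
    (fun y : ℝ => 1 / sqrtSqAdd β y - 1 / sqrtSqAdd α y), integral_one_div_sqrtSqAdd_sub hβ hα,
    abs_of_pos (inv_pos.2 Real.two_pi_pos), real_smul]
  have : (Real.pi : ℂ) ≠ 0 := by exact_mod_cast Real.pi_ne_zero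
  push_cast
  field_simp

lemma tsum_besselK_zero_sub (hβ : 0 < β.re) (hα : 0 < α.re) :
    Real.pi * (1 / β - 1 / α) + 2 * ∑' n : ℕ,
      Real.pi * (1 / sqrtSqAdd β (2 * Real.pi * (n + 1 : ℕ)) -
        1 / sqrtSqAdd α (2 * Real.pi * (n + 1 : ℕ))) =
      log α - log β + 2 * ∑' n : ℕ, (besselK 0 ((n + 1 : ℕ) * β) - besselK 0 ((n + 1 : ℕ) * α)) := by
  set G : ℝ → ℂ := fun ξ =>
    Real.pi * (1 / sqrtSqAdd β (2 * Real.pi * ξ) - 1 / sqrtSqAdd α (2 * Real.pi * ξ)) with hG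
  have hpi := Real.two_pi_pos
  have hc : Continuous G := continuous_const.mul <|
    ((continuous_one_div_sqrtSqAdd hβ).sub (continuous_one_div_sqrtSqAdd hα)).comp
      (continuous_const.mul continuous_id)
  have hO : G =O[cocompact ℝ] fun ξ : ℝ => |ξ| ^ (-2 : ℝ) := by
    have ht : Tendsto (fun ξ : ℝ => 2 * Real.pi * ξ) (cocompact ℝ) (cocompact ℝ) :=
      (Homeomorph.mulLeft₀ (2 * Real.pi) hpi.ne').isClosedEmbedding.tendsto_cocompact
    refine (((isBigO_one_div_sqrtSqAdd_sub hβ hα).comp_tendsto ht).const_mul_left _).trans ?_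
    refine Asymptotics.IsBigO.of_bound (|2 * Real.pi| ^ (-2 : ℝ)) (Eventually.of_forall fun ξ => ?_)
    simp only [Function.comp_apply, abs_mul]
    rw [Real.mul_rpow (by positivity) (by positivity), norm_mul, ← abs_mul,
      Real.norm_of_nonneg (by positivity)]
  have hFn : ∀ n : ℕ, 𝓕 G ((n + 1 : ℕ) : ℤ) =
      besselK 0 ((n + 1 : ℕ) * β) - besselK 0 ((n + 1 : ℕ) * α) := fun n => by
    rw [hG, fourier_one_div_sqrtSqAdd_sub hβ hα (by exact_mod_cast n.succ_ne_zero),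
      abs_of_nonneg (by positivity)]
    simp
  have hFe : ∀ n : ℤ, 𝓕 G ((-n : ℤ) : ℝ) = 𝓕 G (n : ℝ) := fun n => by
    rcases eq_or_ne n 0 with rfl | hn
    · simp
    · have hn' : (n : ℝ) ≠ 0 := by exact_mod_cast hn
      rw [hG, fourier_one_div_sqrtSqAdd_sub hβ hα hn', Int.cast_neg,
        fourier_one_div_sqrtSqAdd_sub hβ hα (neg_ne_zero.2 hn'), abs_neg]
  have hsF := hasSum_int_of_even (f := fun n : ℤ => 𝓕 G n) hFe
    (((summable_besselK_zero hβ).sub (summable_besselK_zero hα)).congr fun n => (hFn n).symm)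
  have hsG : HasSum (fun n : ℤ => G n) _ := hasSum_int_of_even (f := fun n : ℤ => G n)
    (fun n => by simp [hG, sqrtSqAdd_neg])
    (((((summable_one_div_sqrtSqAdd hβ).sub (summable_one_div_sqrtSqAdd hα)).mul_left
      (Real.pi : ℂ))).congr fun n => by simp [hG])
  have hP := Real.tsum_eq_tsum_fourier_of_rpow_decay_of_summable hc one_lt_two hO hsF.summable 0
  simp only [zero_add] at hP
  have h0 : ((0 : ℝ) : UnitAddCircle) = 0 := rfl
  simp only [h0, fourier_eval_zero, mul_one] at hP
  rw [hsG.tsum_eq, hsF.tsum_eq] at hP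
  simp only [hFn, Int.cast_zero] at hP
  rw [fourier_one_div_sqrtSqAdd_sub_zero hβ hα] at hP
  simpa [hG, sqrtSqAdd_zero hβ, sqrtSqAdd_zero hα] using hP

end Poisson

section RealAsymptotics

lemma tendsto_arsinh_mul_sub_log {c : ℝ} (hc : 0 < c) :
    Tendsto (fun N : ℕ => Real.arsinh (c * N) - Real.log N) atTop (𝓝 (Real.log (2 * c))) := by
  have h1 : Tendsto (fun N : ℕ => c + √((1 / (N : ℝ)) ^ 2 + c ^ 2)) atTop
      (𝓝 (c + √(0 ^ 2 + c ^ 2))) :=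
    (((tendsto_one_div_atTop_nhds_zero_nat.pow 2).add_const _).sqrt).const_add c
  have h2 : c + √(0 ^ 2 + c ^ 2) = 2 * c := by
    rw [zero_pow two_ne_zero, zero_add, Real.sqrt_sq hc.le]; ring
  rw [h2] at h1
  refine (h1.log (by positivity)).congr' ?_
  filter_upwards [eventually_gt_atTop 0] with N hN
  have hN' : (0 : ℝ) < N := by exact_mod_cast hN
  have h3 : √(1 + (c * N) ^ 2) = N * √((1 / (N : ℝ)) ^ 2 + c ^ 2) := by
    rw [← Real.sqrt_sq hN'.le, ← Real.sqrt_mul (by positivity), Real.sqrt_sq hN'.le]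
    congr 1; field_simp
  rw [Real.arsinh, h3, mul_comm c, ← mul_add, Real.log_mul hN'.ne' (by positivity)]
  ring

lemma tsum_inv_sqrt_one_add_sq_bounds {c : ℝ} (hc : 0 < c) {S : ℝ}
    (hS : HasSum (fun n : ℕ => (√(1 + (c * (n + 1 : ℕ)) ^ 2))⁻¹ * c - 1 / ((n + 1 : ℕ) : ℝ)) S) :
    S ≤ Real.log (2 * c) - Real.eulerMascheroniConstant ∧
      Real.log (2 * c) - Real.eulerMascheroniConstant ≤ S + c := by
  set F : ℝ → ℝ := fun x => (√(1 + (c * x) ^ 2))⁻¹ * c with hF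
  have hanti : AntitoneOn F (Set.Ici 0) := fun x hx y hy hxy => by
    have : 0 ≤ x := hx
    simp only [hF]
    gcongr
  have hcont : Continuous F :=
    (Continuous.inv₀ (by fun_prop) fun x => by positivity).mul continuous_const
  have hint : ∀ N : ℕ, ∫ x in (0 : ℝ)..(0 + N : ℝ), F x = Real.arsinh (c * N) := fun N => by
    rw [intervalIntegral.integral_eq_sub_of_hasDerivAt (f := fun x => Real.arsinh (c * x))
      (fun x _ => ?_) (hcont.intervalIntegrable _ _)]
    · simp
    · simpa using! (Real.hasDerivAt_arsinh (c * x)).comp x ((hasDerivAt_id x).const_mul c)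
  have hsub : ∀ N : ℕ, AntitoneOn F (Set.Icc 0 (0 + N)) := fun N => hanti.mono fun x hx => hx.1
  have hlim : Tendsto (fun N : ℕ => Real.arsinh (c * N) - harmonic N) atTop
      (𝓝 (Real.log (2 * c) - Real.eulerMascheroniConstant)) :=
    ((tendsto_arsinh_mul_sub_log hc).sub Real.tendsto_harmonic_sub_log).congr fun N => by ring
  have hsum : ∀ N : ℕ, ∑ n ∈ Finset.range N, (F (n + 1 : ℕ) - 1 / ((n + 1 : ℕ) : ℝ)) =
      ∑ n ∈ Finset.range N, F (n + 1 : ℕ) - harmonic N := fun N => by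
    rw [Finset.sum_sub_distrib, harmonic]
    simp
  have hS' := hS.tendsto_sum_nat
  constructor
  · refine le_of_tendsto_of_tendsto' hS' hlim fun N => ?_
    rw [hsum, ← hint]
    have := (hsub N).sum_le_integral
    simp only [zero_add] at this ⊢
    linarith
  · refine le_of_tendsto_of_tendsto' hlim (hS'.add_const c) fun N => ?_
    rw [hsum, ← hint]
    have h1 := (hsub N).integral_le_sum
    have h2 := Finset.sum_range_succ' (fun n : ℕ => F n) N
    rw [Finset.sum_range_succ] at h2
    have h3 : F (0 : ℕ) = c := by simp [hF]
    have h4 : 0 ≤ F N := by positivity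
    simp only [zero_add] at h1 ⊢
    linarith

end RealAsymptotics

section Watson

/-- The right-hand side minus the left-hand side of Watson's identity, without the constants. -/
noncomputable def watsonDefect (β : ℂ) : ℂ :=
  Real.pi * (1 / β + 2 * ∑' n : ℕ, (1 / sqrtSqAdd β (2 * Real.pi * (n + 1 : ℕ)) -
    1 / ((2 * Real.pi * (n + 1 : ℕ) : ℝ) : ℂ))) + log β - 2 * ∑' n : ℕ, besselK 0 ((n + 1 : ℕ) * β)

variable {α β : ℂ}

lemma watsonDefect_eq (hβ : 0 < β.re) (hα : 0 < α.re) : watsonDefect β = watsonDefect α := by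
  have h := tsum_besselK_zero_sub hβ hα
  rw [(summable_besselK_zero hβ).tsum_sub (summable_besselK_zero hα), tsum_mul_left] at h
  have h2 := (summable_one_div_sqrtSqAdd hβ).tsum_sub (summable_one_div_sqrtSqAdd hα)
  simp only [sub_sub_sub_cancel_right] at h2
  rw [h2] at h
  unfold watsonDefect
  linear_combination h

lemma norm_tsum_besselK_zero_ofReal_le {b : ℝ} (hb : 1 ≤ b) :
    ‖∑' n : ℕ, besselK 0 ((n + 1 : ℕ) * (b : ℂ))‖ ≤ Real.exp (1 - b) *
      ((∑' n : ℕ, Real.exp (n * (-1))) *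
        ∫ t in Set.Ioi (0 : ℝ), Real.exp (-(1 : ℂ).re * Real.cosh t)) := by
  have hs : Summable fun n : ℕ => Real.exp (n * (-1)) :=
    Real.summable_exp_nat_mul_iff.2 (by norm_num)
  refine tsum_of_norm_bounded ((hs.hasSum.mul_right _).mul_left _) fun n => ?_
  have hn : (0 : ℝ) ≤ n := n.cast_nonneg
  have h := norm_besselK_zero_le (β := 1) (by simp) (x := (n + 1 : ℕ) * b)
    (by push_cast; nlinarith)
  rw [mul_one, ofReal_mul, ofReal_natCast] at h
  refine h.trans ?_
  rw [← mul_assoc, ← Real.exp_add]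
  refine mul_le_mul_of_nonneg_right (Real.exp_le_exp.2 ?_)
    (integral_nonneg fun t => (Real.exp_pos _).le)
  simp only [one_re]
  push_cast
  nlinarith

lemma norm_watsonDefect_ofReal_add_le {b : ℝ} (hb : 1 ≤ b) :
    ‖watsonDefect b + Real.eulerMascheroniConstant - Real.log (4 * Real.pi)‖ ≤
      3 * Real.pi / b + 2 * (Real.exp (1 - b) * ((∑' n : ℕ, Real.exp (n * (-1))) *
        ∫ t in Set.Ioi (0 : ℝ), Real.exp (-(1 : ℂ).re * Real.cosh t))) := by
  have hb0 : 0 < b := by linarith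
  have hpi := Real.pi_pos
  have hre : 0 < (b : ℂ).re := by simpa
  have hterm : ∀ n : ℕ, 2 * (Real.pi : ℂ) * (1 / sqrtSqAdd b (2 * Real.pi * (n + 1 : ℕ)) -
      1 / ((2 * Real.pi * (n + 1 : ℕ) : ℝ) : ℂ)) =
      (((√(1 + (2 * Real.pi / b * (n + 1 : ℕ)) ^ 2))⁻¹ * (2 * Real.pi / b)
        - 1 / ((n + 1 : ℕ) : ℝ) : ℝ) : ℂ) := fun n => by
    have h3 : √(b ^ 2 + (2 * Real.pi * (n + 1 : ℕ)) ^ 2) =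
        b * √(1 + (2 * Real.pi / b * (n + 1 : ℕ)) ^ 2) := by
      rw [← Real.sqrt_sq hb0.le, ← Real.sqrt_mul (by positivity), Real.sqrt_sq hb0.le]
      congr 1; field_simp
    rw [sqrtSqAdd_ofReal, h3]
    norm_cast
    have : 0 < √(1 + (2 * Real.pi / b * (n + 1 : ℕ)) ^ 2) := by positivity
    set s := √(1 + (2 * Real.pi / b * (n + 1 : ℕ)) ^ 2)
    field_simp
  have hs := ((summable_one_div_sqrtSqAdd hre).mul_left (2 * (Real.pi : ℂ))).congr
    hterm
  obtain ⟨S, hS⟩ := summable_ofReal.1 hs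
  obtain ⟨h1, h2⟩ := tsum_inv_sqrt_one_add_sq_bounds (by positivity) hS
  have hS' : 2 * (Real.pi : ℂ) * ∑' n : ℕ, (1 / sqrtSqAdd b (2 * Real.pi * (n + 1 : ℕ)) -
      1 / ((2 * Real.pi * (n + 1 : ℕ) : ℝ) : ℂ)) = S := by
    rw [← tsum_mul_left]
    simp_rw [hterm]
    exact (hasSum_ofReal.2 hS).tsum_eq
  have hlog : Real.log (2 * (2 * Real.pi / b)) = Real.log (4 * Real.pi) - Real.log b := by
    rw [← Real.log_div (by positivity) hb0.ne']; congr 1; ring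
  rw [hlog] at h1 h2
  have e : watsonDefect b + Real.eulerMascheroniConstant - Real.log (4 * Real.pi) =
      ((Real.pi / b + (S + Real.eulerMascheroniConstant + Real.log b - Real.log (4 * Real.pi)) : ℝ)
        : ℂ) - 2 * ∑' n : ℕ, besselK 0 ((n + 1 : ℕ) * (b : ℂ)) := by
    rw [watsonDefect, ← ofReal_log hb0.le]
    push_cast at hS' ⊢
    linear_combination hS'
  rw [e]
  refine (norm_sub_le _ _).trans (add_le_add ?_ ?_)
  · rw [norm_real, Real.norm_eq_abs, abs_le]
    have h3 : 3 * Real.pi / b = Real.pi / b + 2 * Real.pi / b := by ring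
    have h4 : 0 < Real.pi / b := by positivity
    have h5 : 2 * Real.pi / b = 2 * (Real.pi / b) := by ring
    constructor <;> linarith
  · rw [norm_mul, Complex.norm_ofNat]
    gcongr
    exact norm_tsum_besselK_zero_ofReal_le hb

lemma watsonDefect_add_eq_zero (hβ : 0 < β.re) :
    watsonDefect β + Real.eulerMascheroniConstant - Real.log (4 * Real.pi) = 0 := by
  refine norm_le_zero_iff.1 ?_
  set C := (∑' n : ℕ, Real.exp (n * (-1))) *
    ∫ t in Set.Ioi (0 : ℝ), Real.exp (-(1 : ℂ).re * Real.cosh t)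
  have h1 : Tendsto (fun b : ℝ => 3 * Real.pi / b + 2 * (Real.exp (1 - b) * C)) atTop
      (𝓝 (0 + 2 * (0 * C))) :=
    (tendsto_const_nhds.div_atTop tendsto_id).add
      (((Real.tendsto_exp_atBot.comp (tendsto_atBot_add_const_left atTop 1
        tendsto_neg_atTop_atBot)).mul_const C).const_mul 2)
  rw [zero_mul, mul_zero, add_zero] at h1
  refine ge_of_tendsto h1 ?_
  filter_upwards [eventually_ge_atTop 1] with b hb
  rw [watsonDefect_eq hβ (α := b) (by simp; linarith)]
  exact norm_watsonDefect_ofReal_add_le hb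

end Watson

/-- **Watson's `K₀` identity.**  For `β ∈ ℂ` with `Re β > 0`,
`2 ∑_{n=1}^∞ K_0(nβ)
  = π (1/β + 2 ∑_{n=1}^∞ (1/√(β² + 4π²n²) - 1/(2nπ))) + γ + log(β/2) - log(2π)`,
both series converging absolutely. -/
theorem watson_K0_identity (β : ℂ) (hβ : 0 < β.re) :
    Summable (fun n : ℕ => besselK 0 ((n+1 : ℕ) * β)) ∧
    Summable (fun n : ℕ =>
      1 / (β^2 + 4 * (Real.pi : ℂ)^2 * ((n+1 : ℕ) : ℂ)^2) ^ ((1:ℂ)/2)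
        - 1 / (2 * (n+1 : ℕ) * (Real.pi : ℂ))) ∧
    2 * ∑' n : ℕ, besselK 0 ((n+1 : ℕ) * β)
      = (Real.pi : ℂ) * (1/β + 2 * ∑' n : ℕ,
            (1 / (β^2 + 4 * (Real.pi : ℂ)^2 * ((n+1 : ℕ) : ℂ)^2) ^ ((1:ℂ)/2)
              - 1 / (2 * (n+1 : ℕ) * (Real.pi : ℂ))))
        + (Real.eulerMascheroniConstant : ℂ) + Complex.log (β/2)
        - Complex.log (2 * Real.pi) := by
  have hterm : ∀ n : ℕ, 1 / (β^2 + 4 * (Real.pi : ℂ)^2 * ((n+1 : ℕ) : ℂ)^2) ^ ((1:ℂ)/2)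
        - 1 / (2 * (n+1 : ℕ) * (Real.pi : ℂ)) =
      1 / sqrtSqAdd β (2 * Real.pi * (n + 1 : ℕ)) -
        1 / ((2 * Real.pi * (n + 1 : ℕ) : ℝ) : ℂ) := fun n => by
    have e1 : β ^ 2 + 4 * (Real.pi : ℂ) ^ 2 * ((n + 1 : ℕ) : ℂ) ^ 2 =
        β ^ 2 + ((2 * Real.pi * (n + 1 : ℕ) : ℝ) : ℂ) ^ 2 := by push_cast; ring
    have e2 : 2 * ((n + 1 : ℕ) : ℂ) * (Real.pi : ℂ) =
        ((2 * Real.pi * (n + 1 : ℕ) : ℝ) : ℂ) := by push_cast; ring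
    rw [sqrtSqAdd, e1, e2]
  simp_rw [hterm]
  refine ⟨summable_besselK_zero hβ, summable_one_div_sqrtSqAdd hβ, ?_⟩
  have h := watsonDefect_add_eq_zero hβ
  have hβ0 : β ≠ 0 := fun h => by simp [h] at hβ
  have h2 : log (β / 2) = log β - Real.log 2 := by
    rw [div_eq_mul_inv, mul_comm, show ((2 : ℂ)⁻¹) = ((2⁻¹ : ℝ) : ℂ) by norm_num,
      log_ofReal_mul (by norm_num) hβ0, Real.log_inv]
    push_cast; ring
  have h3 : log (2 * Real.pi) = Real.log (2 * Real.pi) := by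
    rw [ofReal_log Real.two_pi_pos.le]; push_cast; rfl
  have h4 : Real.log (4 * Real.pi) = Real.log 2 + Real.log (2 * Real.pi) := by
    rw [← Real.log_mul two_ne_zero Real.two_pi_pos.ne']; congr 1; ring
  rw [h4, watsonDefect] at h
  rw [h2, h3]
  push_cast at h ⊢
  linear_combination -h
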